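/- arXiv:1709.05284 — 2 statements merged into one kernel-verified Lean document; each statement's English description precedes it below -/
import Mathlib

section
/- There exists a constant C(n) > 0, depending only on the dimension n, such that for every r > 0 and every bounded convex set E ⊆ ℝⁿ with |E| > 0, one has diam(E) ≤ C(n) · Per_r(E)^{n−1} · |E|^{2−n}. -/
open MeasureTheory Metric Set Filter Bornology
open scoped ENNReal NNReal Pointwise

noncomputable section

/-- The set of points of Lebesgue density one of `E ⊆ ℝⁿ`. -/
def densityOnePoints (n : ℕ) (E : Set (EuclideanSpace ℝ (Fin n))) :
    Set (EuclideanSpace ℝ (Fin n)) :=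
  {x | Tendsto (fun ρ : ℝ => volume (E ∩ ball x ρ) / volume (ball x ρ))
        (nhdsWithin 0 (Ioi 0)) (nhds 1)}

/-- Minkowski sum `A ⊕ B_r = ⋃_{x ∈ A} B_r(x)`. -/
def minkSum (n : ℕ) (r : ℝ) (A : Set (EuclideanSpace ℝ (Fin n))) :
    Set (EuclideanSpace ℝ (Fin n)) :=
  ⋃ x ∈ A, ball x r

/-- The nonlocal Minkowski perimeter `Per_r(E) = (1/(2r)) |(∂E) ⊕ B_r|`, where `∂E`
is the topological boundary of the density-one representative of `E`. -/
def perR (n : ℕ) (r : ℝ) (E : Set (EuclideanSpace ℝ (Fin n))) : ℝ≥0∞ :=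
  volume (minkSum n r (frontier (densityOnePoints n E))) / ENNReal.ofReal (2 * r)

/-- The inner set `E ⊖ B_r = E \ ((∂E) ⊕ B_r)` (for the density-one representative). -/
def minkSub (n : ℕ) (r : ℝ) (E : Set (EuclideanSpace ℝ (Fin n))) :
    Set (EuclideanSpace ℝ (Fin n)) :=
  densityOnePoints n E \ minkSum n r (frontier (densityOnePoints n E))

/-- The Riesz energy `Φ_α(E) = ∫_E ∫_E |x-y|^{-α} dx dy`. -/
def rieszEnergy (n : ℕ) (α : ℝ) (E : Set (EuclideanSpace ℝ (Fin n))) : ℝ≥0∞ :=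
  ∫⁻ x in E, ∫⁻ y in E, edist x y ^ (-α)

/-- The radius of the ball in `ℝⁿ` with unit volume. -/
def unitRadius (n : ℕ) : ℝ :=
  (volume (ball (0 : EuclideanSpace ℝ (Fin n)) 1)).toReal ^ (-(n : ℝ)⁻¹)

/-- A rigid motion of `ℝⁿ`: a rotation followed by a translation. -/
def IsRigidMotion (n : ℕ) (g : EuclideanSpace ℝ (Fin n) → EuclideanSpace ℝ (Fin n)) : Prop :=
  ∃ (R : EuclideanSpace ℝ (Fin n) ≃ₗᵢ[ℝ] EuclideanSpace ℝ (Fin n))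
    (v : EuclideanSpace ℝ (Fin n)),
    LinearMap.det (R.toLinearEquiv : EuclideanSpace ℝ (Fin n) →ₗ[ℝ] EuclideanSpace ℝ (Fin n)) = 1 ∧
    ∀ x, g x = R x + v

lemma aux_section (m : ℕ) (hm : 1 ≤ m) (V : Set (Fin m → ℝ)) (hV : MeasurableSet V)
    (g : (Fin m → ℝ) → ℝ≥0∞) (hg : Measurable g)
    (h : ∀ y ∈ V, ∀ j, 1 ≤ ∫⁻ τ, g (Function.update y j τ)) :
    volume V ≤ volume V ^ (1 / (m : ℝ)) * ∫⁻ y, g y := by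
  rcases eq_or_lt_of_le hm with rfl | hm2
  · rcases V.eq_empty_or_nonempty with rfl | ⟨y, hy⟩
    · simp
    · have h1 := h y hy 0
      have h2 : ∫⁻ y, g y = ∫⁻ τ, g (Function.update y 0 τ) := by
        have e := ((volume_preserving_funUnique (Fin 1) ℝ).symm _).lintegral_comp hg
        have e2 : ∫⁻ y, g y = ∫⁻ τ, g ((MeasurableEquiv.funUnique (Fin 1) ℝ).symm τ) := by
          convert e.symm
        rw [e2]
        congr 1
        ext τ
        congr 1
        ext k
        have : k = 0 := Subsingleton.elim _ _
        subst this
        simp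
      rw [h2]
      simp only [Nat.cast_one, div_one, ENNReal.rpow_one]
      exact le_mul_of_one_le_right zero_le h1
  · have hm0 : (1 : ℝ) < m := by exact_mod_cast hm2
    have hc : ((Fintype.card (Fin m) : ℕ) : ℝ).HolderConjugate (Real.conjExponent m) := by
      simpa using Real.HolderConjugate.conjExponent hm0
    have key := lintegral_prod_lintegral_pow_le (fun _ : Fin m => (volume : Measure ℝ)) hc hg
    have h1 : volume V ≤ (∫⁻ y, g y) ^ (Real.conjExponent m) := by
      refine le_trans ?_ key
      rw [← lintegral_indicator_one hV]
      refine lintegral_mono fun y => ?_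
      by_cases hy : y ∈ V
      · simp only [hy, indicator_of_mem, Pi.one_apply]
        refine Finset.one_le_prod' fun j _ => ?_
        refine ENNReal.one_le_rpow (h y hy j) ?_
        rw [Fintype.card_fin]
        exact one_div_pos.2 (by linarith)
      · simp [hy]
    have h2 : volume V ^ (1 - 1 / (m : ℝ)) ≤ ∫⁻ y, g y := by
      have e : (Real.conjExponent m) * (1 - 1 / (m : ℝ)) = 1 := by
        have : (m : ℝ) - 1 ≠ 0 := by linarith
        rw [Real.conjExponent]; field_simp
      have h0 : 0 ≤ (1 - 1 / (m : ℝ)) := by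
        rw [sub_nonneg, div_le_one (by linarith)]; linarith
      have := ENNReal.rpow_le_rpow h1 h0
      rwa [← ENNReal.rpow_mul, e, ENNReal.rpow_one] at this
    calc volume V = volume V ^ (1 / (m : ℝ)) * volume V ^ (1 - 1 / (m : ℝ)) := by
          rw [← ENNReal.rpow_add_of_nonneg]
          · simp
          · positivity
          · rw [sub_nonneg, div_le_one (by linarith)]; linarith
      _ ≤ _ := by gcongr

def slice {m : ℕ} (i : Fin (m + 1)) (U : Set (Fin (m + 1) → ℝ)) (t : ℝ) : Set (Fin m → ℝ) :=
  {y | (i.insertNth t y : Fin (m + 1) → ℝ) ∈ U}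

lemma aux_meas_insert {m : ℕ} (i : Fin (m + 1)) :
    Measurable (fun q : ℝ × (Fin m → ℝ) => (i.insertNth q.1 q.2 : Fin (m + 1) → ℝ)) :=
  (MeasurableEquiv.piFinSuccAbove (fun _ : Fin (m + 1) => ℝ) i).symm.measurable

lemma aux_fubini {m : ℕ} (i : Fin (m + 1)) (f : (Fin (m + 1) → ℝ) → ℝ≥0∞) (hf : Measurable f) :
    ∫⁻ x, f x = ∫⁻ t : ℝ, ∫⁻ y : Fin m → ℝ, f (i.insertNth t y) := by
  rw [← ((volume_preserving_piFinSuccAbove (fun _ : Fin (m + 1) => ℝ) i).symm).lintegral_comp hf]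
  rw [Measure.volume_eq_prod, lintegral_prod]
  · rfl
  · exact (hf.comp (aux_meas_insert i)).aemeasurable

lemma aux_slice_meas {m : ℕ} (i : Fin (m + 1)) (U : Set (Fin (m + 1) → ℝ)) (hU : MeasurableSet U)
    (t : ℝ) : MeasurableSet (slice i U t) :=
  ((aux_meas_insert i).comp measurable_prodMk_left) hU

lemma aux_vol {m : ℕ} (i : Fin (m + 1)) (U : Set (Fin (m + 1) → ℝ)) (hU : MeasurableSet U) :
    volume U = ∫⁻ t : ℝ, volume (slice i U t) := by
  rw [← lintegral_indicator_one hU, aux_fubini i _ (measurable_one.indicator hU)]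
  congr 1
  ext t
  rw [← lintegral_indicator_one (aux_slice_meas i U hU t)]
  rfl

lemma aux_cone1 {m : ℕ} (i : Fin (m + 1)) (U : Set (Fin (m + 1) → ℝ)) (hc : Convex ℝ U)
    (p : Fin (m + 1) → ℝ) (hp : p ∈ U) (t l : ℝ) (hl : 0 ≤ l) (hl2 : l ≤ 1 / 2) :
    volume (slice i U t) ≤ 2 ^ m * volume (slice i U ((1 - l) * t + l * p i)) := by
  have hsub : AffineMap.homothety (i.removeNth p : Fin m → ℝ) (1 - l) '' (slice i U t) ⊆
      slice i U ((1 - l) * t + l * p i) := by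
    rintro _ ⟨y, hy, rfl⟩
    have := hc hy hp (show 0 ≤ 1 - l by linarith) hl (by ring)
    simp only [slice, mem_ofPred_eq]
    convert this using 1
    ext k
    refine i.succAboveCases ?_ (fun j => ?_) k
    · simp
    · simp [AffineMap.homothety_apply, Fin.removeNth]; ring
  have h1 := measure_mono (μ := volume) hsub
  rw [Measure.addHaar_image_homothety] at h1
  have h2 : (1 : ℝ≥0∞) ≤ 2 ^ m * ENNReal.ofReal |(1 - l) ^ Module.finrank ℝ (Fin m → ℝ)| := by
    rw [Module.finrank_fin_fun, abs_of_nonneg (pow_nonneg (by linarith) _),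
      show (2 : ℝ≥0∞) ^ m = ENNReal.ofReal (2 ^ m) by simp [ENNReal.ofReal_pow],
      ← ENNReal.ofReal_mul (by positivity), ← mul_pow, ← ENNReal.ofReal_one]
    exact ENNReal.ofReal_le_ofReal (one_le_pow₀ (by linarith))
  calc volume (slice i U t) ≤ (2 ^ m * ENNReal.ofReal |(1 - l) ^ Module.finrank ℝ (Fin m → ℝ)|) *
        volume (slice i U t) := le_mul_of_one_le_left zero_le h2
    _ ≤ _ := by rw [mul_assoc]; gcongr

lemma aux_cone {m : ℕ} (i : Fin (m + 1)) (U : Set (Fin (m + 1) → ℝ)) (hc : Convex ℝ U)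
    (hU : MeasurableSet U)
    (p : Fin (m + 1) → ℝ) (hp : p ∈ U) (t : ℝ) :
    ENNReal.ofReal (|p i - t| / 2) * volume (slice i U t) ≤ 2 ^ m * volume U := by
  have hvol : volume (uIcc t ((t + p i) / 2)) = ENNReal.ofReal (|p i - t| / 2) := by
    rw [uIcc, Real.volume_Icc, max_sub_min_eq_abs]
    congr 1
    rw [show (t + p i) / 2 - t = (p i - t) / 2 by ring, abs_div]; simp
  rw [aux_vol i U hU, ← lintegral_const_mul' _ _ (by simp), ← hvol, mul_comm,
    ← setLIntegral_const]
  refine le_trans ?_ (setLIntegral_le_lintegral (uIcc t ((t + p i) / 2)) _)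
  refine setLIntegral_mono' measurableSet_uIcc fun t' ht' => ?_
  rw [← segment_eq_uIcc] at ht'
  obtain ⟨a, b, ha, hb, hab, rfl⟩ := ht'
  convert aux_cone1 i U hc p hp t (b / 2) (by positivity) (by linarith) using 4
  simp only [smul_eq_mul]
  obtain rfl : a = 1 - b := by linarith
  ring

lemma aux_slice_le {m : ℕ} (i : Fin (m + 1)) (U : Set (Fin (m + 1) → ℝ)) (hc : Convex ℝ U)
    (hU : MeasurableSet U)
    (p q : Fin (m + 1) → ℝ) (hp : p ∈ U) (hq : q ∈ U) (t : ℝ) :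
    ENNReal.ofReal (|p i - q i| / 4) * volume (slice i U t) ≤ 2 ^ m * volume U := by
  have : |p i - q i| / 4 ≤ |p i - t| / 2 ∨ |p i - q i| / 4 ≤ |q i - t| / 2 := by
    have := abs_sub_le (p i) t (q i)
    rw [abs_sub_comm t] at this
    by_contra! hh
    linarith
  rcases this with h | h
  · exact le_trans (by gcongr) (aux_cone i U hc hU p hp t)
  · exact le_trans (by gcongr) (aux_cone i U hc hU q hq t)

lemma aux_core {m : ℕ} (i : Fin (m + 1)) (U : Set (Fin (m + 1) → ℝ)) (hc : Convex ℝ U)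
    (hU : MeasurableSet U) (hfin : volume U ≠ ∞) (hpos : volume U ≠ 0)
    (f : (Fin (m + 1) → ℝ) → ℝ≥0∞) (hf : Measurable f)
    (h : ∀ x ∈ U, ∀ j, 1 ≤ ∫⁻ τ, f (Function.update x j τ))
    (p q : Fin (m + 1) → ℝ) (hp : p ∈ U) (hq : q ∈ U) :
    ENNReal.ofReal (|p i - q i| / 4) * volume U ^ m ≤
      2 ^ m * volume U * (∫⁻ x, f x) ^ m := by
  rcases Nat.eq_zero_or_pos m with rfl | hm
  · have := aux_slice_le i U hc hU p q hp hq (p i)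
    have h1 : slice i U (p i) = univ := by
      ext y
      simp only [slice, mem_ofPred_eq, mem_univ, iff_true]
      convert hp
      ext k
      refine i.succAboveCases ?_ (fun j => j.elim0) k
      simp
    rw [h1, volume_pi, Measure.pi_univ] at this
    simpa using this
  set s := ENNReal.ofReal (|p i - q i| / 4) with hs
  rcases eq_or_ne s 0 with h0 | h0
  · simp [h0]
  have hst : s ≠ ∞ := ENNReal.ofReal_ne_top
  have hm' : (m : ℝ) ≠ 0 := by positivity
  set M := 2 ^ m * volume U / s with hM
  have hle : ∀ t, volume (slice i U t) ≤ M := fun t => by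
    rw [hM, ENNReal.le_div_iff_mul_le (Or.inl h0) (Or.inl hst), mul_comm]
    exact aux_slice_le i U hc hU p q hp hq t
  have hMt : M ≠ ∞ := ENNReal.div_ne_top (ENNReal.mul_ne_top (by simp) hfin) h0
  have h1 : volume U ≤ M ^ (1 / (m : ℝ)) * ∫⁻ x, f x := by
    rw [aux_vol i U hU, aux_fubini i f hf,
      ← lintegral_const_mul' _ _ (ENNReal.rpow_ne_top_of_nonneg (by positivity) hMt)]
    refine lintegral_mono fun t => ?_
    refine (aux_section m hm (slice i U t) (aux_slice_meas i U hU t)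
      (fun y => f (i.insertNth t y))
      (hf.comp ((aux_meas_insert i).comp measurable_prodMk_left)) ?_).trans ?_
    · intro y hy j
      have := h _ hy (i.succAbove j)
      simpa only [Fin.insertNth_update] using this
    · gcongr
      exact hle t
  have h2 : volume U ^ m ≤ M * (∫⁻ x, f x) ^ m := by
    have := pow_le_pow_left₀ zero_le h1 m
    rwa [mul_pow, ← ENNReal.rpow_natCast (M ^ _), ← ENNReal.rpow_mul, one_div,
      inv_mul_cancel₀ hm', ENNReal.rpow_one] at this
  calc s * volume U ^ m ≤ s * (M * (∫⁻ x, f x) ^ m) := by gcongr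
    _ = (s * M) * (∫⁻ x, f x) ^ m := by ring
    _ = _ := by rw [hM, ENNReal.mul_div_cancel h0 hst]

lemma aux_interior_sub {n : ℕ} (E : Set (EuclideanSpace ℝ (Fin n))) :
    interior E ⊆ densityOnePoints n E := by
  intro x hx
  obtain ⟨ε, hε, hb⟩ := Metric.isOpen_iff.1 isOpen_interior x hx
  refine tendsto_const_nhds.congr' ?_
  filter_upwards [Ioo_mem_nhdsGT hε] with ρ hρ
  have h1 : E ∩ ball x ρ = ball x ρ := by
    rw [inter_eq_right]
    exact (ball_subset_ball hρ.2.le).trans (hb.trans interior_subset)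
  rw [h1, ENNReal.div_self (measure_ball_pos _ _ hρ.1).ne' measure_ball_lt_top.ne]

lemma aux_sub_closure {n : ℕ} (E : Set (EuclideanSpace ℝ (Fin n))) :
    densityOnePoints n E ⊆ closure E := by
  intro x hx
  by_contra hxc
  obtain ⟨ε, hε, hb⟩ := Metric.isOpen_iff.1 isClosed_closure.isOpen_compl x hxc
  have h0 : Tendsto (fun ρ : ℝ => volume (E ∩ ball x ρ) / volume (ball x ρ))
        (nhdsWithin 0 (Ioi 0)) (nhds 0) := by
    refine tendsto_const_nhds.congr' ?_
    filter_upwards [Ioo_mem_nhdsGT hε] with ρ hρ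
    have h1 : E ∩ ball x ρ = ∅ := by
      rw [← disjoint_iff_inter_eq_empty, disjoint_right]
      intro y hy hyE
      exact hb (ball_subset_ball hρ.2.le hy) (subset_closure hyE)
    simp [h1]
  exact zero_ne_one (tendsto_nhds_unique h0 hx)

lemma aux_frontier {n : ℕ} (E : Set (EuclideanSpace ℝ (Fin n))) (hc : Convex ℝ E)
    (hne : (interior E).Nonempty) :
    frontier (interior E) ⊆ frontier (densityOnePoints n E) := by
  rw [isOpen_interior.frontier_eq]
  rintro x ⟨hx1, hx2⟩
  refine ⟨closure_mono (aux_interior_sub E) hx1, fun h => hx2 ?_⟩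
  rw [← hc.interior_closure_eq_interior_of_nonempty_interior hne]
  exact interior_mono (aux_sub_closure E) h

lemma aux_isom {n : ℕ} (x : Fin n → ℝ) (j : Fin n) :
    Isometry (fun τ : ℝ => (WithLp.toLp 2 (Function.update x j τ) : EuclideanSpace ℝ (Fin n))) := by
  refine Isometry.of_dist_eq fun a b => ?_
  rw [EuclideanSpace.dist_eq, Finset.sum_eq_single j]
  · simp
  · intro k _ hk
    simp [hk]
  · simp

lemma aux_line {n : ℕ} {r : ℝ} (hr : 0 < r) (U : Set (EuclideanSpace ℝ (Fin n))) (hU : IsOpen U)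
    (hb : IsBounded U) (x : Fin n → ℝ) (hx : WithLp.toLp 2 x ∈ U) (j : Fin n) :
    ENNReal.ofReal (2 * r) ≤ volume {τ : ℝ |
      (WithLp.toLp 2 (Function.update x j τ) : EuclideanSpace ℝ (Fin n)) ∈
        minkSum n r (frontier U)} := by
  set L := fun τ : ℝ => (WithLp.toLp 2 (Function.update x j τ) : EuclideanSpace ℝ (Fin n)) with hL
  have hiso : Isometry L := aux_isom x j
  set V := L ⁻¹' U with hV
  have hVo : IsOpen V := hU.preimage hiso.continuous
  have hVb : IsBounded V := hiso.antilipschitz.isBounded_preimage hb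
  have hVn : V.Nonempty := ⟨x j, by simpa [hV, hL] using hx⟩
  have hfr : ∀ a ∈ frontier V, L a ∈ frontier U := by
    intro a ha
    exact (hiso.continuous.frontier_preimage_subset U) ha
  have hS : sSup V ∈ frontier V := by
    rw [hVo.frontier_eq]
    refine ⟨csSup_mem_closure hVn hVb.bddAbove, fun h => ?_⟩
    obtain ⟨ε, hε, hb'⟩ := Metric.isOpen_iff.1 hVo _ h
    have : sSup V + ε / 2 ∈ V := hb' (by simp [abs_of_pos hε]; linarith)
    have := le_csSup hVb.bddAbove this
    linarith
  have hI : sInf V ∈ frontier V := by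
    rw [hVo.frontier_eq]
    refine ⟨csInf_mem_closure hVn hVb.bddBelow, fun h => ?_⟩
    obtain ⟨ε, hε, hb'⟩ := Metric.isOpen_iff.1 hVo _ h
    have : sInf V - ε / 2 ∈ V := hb' (by simp [abs_of_pos hε]; linarith)
    have := csInf_le hVb.bddBelow this
    linarith
  have hle : sInf V ≤ sSup V := csInf_le_csSup hVn hVb.bddBelow hVb.bddAbove
  have hnear : ∀ a ∈ frontier V, ∀ τ, |τ - a| < r → L τ ∈ minkSum n r (frontier U) := by
    intro a ha τ hτ
    refine mem_iUnion₂.2 ⟨L a, hfr a ha, ?_⟩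
    rw [mem_ball, hiso.dist_eq, Real.dist_eq]
    exact hτ
  have hsub : Ioo (sInf V - r) (sInf V) ∪ Ioo (sSup V) (sSup V + r) ⊆
      {τ : ℝ | L τ ∈ minkSum n r (frontier U)} := by
    rintro τ (h | h)
    · refine hnear _ hI τ ?_
      rw [abs_lt]; constructor <;> linarith [h.1, h.2]
    · refine hnear _ hS τ ?_
      rw [abs_lt]; constructor <;> linarith [h.1, h.2]
  refine le_trans ?_ (measure_mono hsub)
  rw [measure_union _ measurableSet_Ioo, Real.volume_Ioo, Real.volume_Ioo,
    ← ENNReal.ofReal_add (by linarith) (by linarith)]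
  · exact ENNReal.ofReal_le_ofReal (by linarith)
  · rw [disjoint_left]
    intro τ h1 h2
    linarith [h1.2, h2.1]

lemma aux_open {n : ℕ} (r : ℝ) (A : Set (EuclideanSpace ℝ (Fin n))) : IsOpen (minkSum n r A) :=
  isOpen_biUnion fun _ _ => isOpen_ball

lemma aux_euclid {m : ℕ} {r : ℝ} (hr : 0 < r) (U : Set (EuclideanSpace ℝ (Fin (m + 1))))
    (hU : IsOpen U) (hc : Convex ℝ U) (hb : IsBounded U) (hpos : volume U ≠ 0)
    (p q : EuclideanSpace ℝ (Fin (m + 1))) (hp : p ∈ U) (hq : q ∈ U) (i : Fin (m + 1)) :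
    ENNReal.ofReal (|p i - q i| / 4) * volume U ^ m ≤ 2 ^ m * volume U *
      (volume (minkSum (m + 1) r (frontier U)) / ENNReal.ofReal (2 * r)) ^ m := by
  have mp := PiLp.volume_preserving_toLp (Fin (m + 1))
  set G := minkSum (m + 1) r (frontier U) with hG
  set T : (Fin (m + 1) → ℝ) → EuclideanSpace ℝ (Fin (m + 1)) := WithLp.toLp 2 with hT
  have hGm : MeasurableSet (T ⁻¹' G) := mp.measurable (aux_open r _).measurableSet
  have hUm : MeasurableSet (T ⁻¹' U) := mp.measurable hU.measurableSet
  have hvU : volume (T ⁻¹' U) = volume U := mp.measure_preimage hU.measurableSet.nullMeasurableSet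
  have hvG : volume (T ⁻¹' G) = volume G :=
    mp.measure_preimage (aux_open r _).measurableSet.nullMeasurableSet
  have hr0 : ENNReal.ofReal (2 * r) ≠ 0 := by simpa using hr
  have hcT : Convex ℝ (T ⁻¹' U) := by
    intro a ha b hb' s t hs ht hst
    exact hc ha hb' hs ht hst
  have hfin : volume U ≠ ∞ := hb.measure_lt_top.ne
  have key := aux_core i (T ⁻¹' U) hcT hUm (by rwa [hvU]) (by rwa [hvU])
    ((T ⁻¹' G).indicator fun _ => (ENNReal.ofReal (2 * r))⁻¹) (measurable_const.indicator hGm)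
    (by
      intro x hx j
      have h1 := aux_line hr U hU hb x hx j
      have hmeas : MeasurableSet {τ : ℝ | T (Function.update x j τ) ∈ G} :=
        (aux_isom x j).continuous.measurable (aux_open r _).measurableSet
      have h2 : ∫⁻ τ, (T ⁻¹' G).indicator (fun _ => (ENNReal.ofReal (2 * r))⁻¹)
          (Function.update x j τ) = (ENNReal.ofReal (2 * r))⁻¹ *
            volume {τ : ℝ | T (Function.update x j τ) ∈ G} := by
        rw [← lintegral_indicator_const hmeas]
        rfl
      rw [h2, ← ENNReal.inv_mul_cancel hr0 ENNReal.ofReal_ne_top]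
      gcongr)
    (WithLp.ofLp p) (WithLp.ofLp q) hp hq
  rwa [lintegral_indicator_const hGm, hvU, hvG, mul_comm _ (volume G), ← div_eq_mul_inv] at key

/-- Isodiametric estimate for convex sets in terms of the Minkowski perimeter. -/
theorem diam_le_perR_pow (n : ℕ) (hn : 1 ≤ n) :
    ∃ C : ℝ, 0 < C ∧
      ∀ (r : ℝ) (E : Set (EuclideanSpace ℝ (Fin n))), 0 < r → IsBounded E → Convex ℝ E →
        0 < volume E →
        Metric.diam E ≤ C * (perR n r E).toReal ^ (n - 1) *
          (volume E).toReal ^ (2 - (n : ℝ)) := by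
  obtain ⟨m, rfl⟩ : ∃ m, n = m + 1 := ⟨n - 1, by omega⟩
  refine ⟨√(m + 1) * (4 * 2 ^ m), by positivity, ?_⟩
  intro r E hr hb hc hpos
  have hvol : volume (interior E) = volume E := by
    refine le_antisymm (measure_mono interior_subset) ?_
    calc volume E ≤ volume (interior E ∪ frontier E) := by
          refine measure_mono ?_
          rw [← closure_eq_interior_union_frontier]
          exact subset_closure
      _ ≤ volume (interior E) + volume (frontier E) := measure_union_le _ _
      _ = _ := by rw [hc.addHaar_frontier volume, add_zero]
  have hne : (interior E).Nonempty := by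
    rw [nonempty_iff_ne_empty]
    intro h
    rw [h, measure_empty] at hvol
    exact hpos.ne hvol
  have hdiam : Metric.diam E = Metric.diam (interior E) := by
    rw [← Metric.diam_closure E, ← hc.closure_interior_eq_closure_of_nonempty_interior hne,
      Metric.diam_closure]
  have hfin : volume E ≠ ∞ := hb.measure_lt_top.ne
  have hPfin : perR (m + 1) r E ≠ ∞ := by
    refine ENNReal.div_ne_top ?_ (by simpa using hr)
    have hbd : IsBounded (minkSum (m + 1) r (frontier (densityOnePoints (m + 1) E))) := by
      have h1 : IsBounded (frontier (densityOnePoints (m + 1) E)) :=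
        hb.closure.subset (frontier_subset_closure.trans
          (closure_minimal (aux_sub_closure E) isClosed_closure))
      refine (h1.thickening (δ := r)).subset ?_
      rw [thickening_eq_biUnion_ball]
      exact subset_rfl
    exact hbd.measure_lt_top.ne
  have hPle : volume (minkSum (m + 1) r (frontier (interior E))) / ENNReal.ofReal (2 * r) ≤
      perR (m + 1) r E := by
    unfold perR
    gcongr
    exact biUnion_subset_biUnion_left (aux_frontier E hc hne)
  set P := (perR (m + 1) r E).toReal with hP
  set v := (volume E).toReal with hv
  have hv0 : 0 < v := ENNReal.toReal_pos hpos.ne' hfin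
  set B := (4 * 2 ^ m) * P ^ m * v ^ (2 - ((m + 1 : ℕ) : ℝ)) with hB
  have hcoord : ∀ p ∈ interior E, ∀ q ∈ interior E, ∀ i, |p i - q i| ≤ B := by
    intro p hp q hq i
    have h1 := aux_euclid hr (interior E) isOpen_interior hc.interior (hb.subset interior_subset)
      (by rw [hvol]; exact hpos.ne') p q hp hq i
    rw [hvol] at h1
    have h2 := h1.trans (mul_le_mul_right (pow_le_pow_left₀ zero_le hPle m) _)
    have h3 := ENNReal.toReal_mono (by finiteness) h2
    simp only [ENNReal.toReal_mul, ENNReal.toReal_pow, ENNReal.toReal_ofNat] at h3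
    rw [ENNReal.toReal_ofReal (by positivity), ← hP, ← hv] at h3
    have h4 : v ^ (2 - ((m + 1 : ℕ) : ℝ)) = v / v ^ m := by
      rw [show 2 - ((m + 1 : ℕ) : ℝ) = 1 - (m : ℝ) by push_cast; ring, Real.rpow_sub hv0,
        Real.rpow_one, Real.rpow_natCast]
    rw [hB, h4, ← mul_div_assoc, le_div_iff₀ (by positivity)]
    linarith
  have hB0 : 0 ≤ B := by positivity
  rw [hdiam]
  have hfinal : √(m + 1) * (4 * 2 ^ m) * P ^ (m + 1 - 1) * v ^ (2 - ((m + 1 : ℕ) : ℝ)) =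
      √(m + 1) * B := by
    rw [hB, Nat.add_sub_cancel]; ring
  rw [hfinal]
  refine Metric.diam_le_of_forall_dist_le (by positivity) fun p hp q hq => ?_
  rw [EuclideanSpace.dist_eq]
  calc √(∑ i, dist (p i) (q i) ^ 2) ≤ √(∑ _i : Fin (m + 1), B ^ 2) := by
        gcongr with i
        rw [Real.dist_eq]
        exact hcoord p hp q hq i
    _ = √(m + 1) * B := by
        rw [Finset.sum_const, Finset.card_univ, Fintype.card_fin, nsmul_eq_mul,
          Real.sqrt_mul (by positivity), Real.sqrt_sq hB0]
        push_cast
        rfl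
end
end

section
/- Existence of minimizers: let n ≥ 2, α ∈ (0,n), r > 0. For every m > 0 there exists a bounded convex set E_m ⊆ ℝⁿ with |E_m| = m such that Per_{r m^{1/n}}(E_m) + Φ_α(E_m) ≤ Per_{r m^{1/n}}(F) + Φ_α(F) for every bounded convex set F ⊆ ℝⁿ with |F| = m. -/
open MeasureTheory Metric Set Filter Bornology
open scoped ENNReal NNReal Pointwise

noncomputable section

/-! ## Topological preliminaries -/

/-- A preconnected set meeting both `t` and its complement meets the frontier of `t`. -/
lemma preconn_meets_frontier {X : Type*} [TopologicalSpace X] {s t : Set X}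
    (hs : IsPreconnected s) (h1 : (s ∩ t).Nonempty) (h2 : (s ∩ tᶜ).Nonempty) :
    (s ∩ frontier t).Nonempty := by
  by_contra h
  rw [Set.not_nonempty_iff_eq_empty] at h
  have key : ∀ x ∈ s, x ∈ interior t ∨ x ∈ (closure t)ᶜ := by
    intro x hx
    by_contra hc
    push Not at hc
    have : x ∈ s ∩ frontier t := ⟨hx, not_not.1 hc.2, hc.1⟩
    rw [h] at this
    exact this
  obtain ⟨a, has, hat⟩ := h1
  obtain ⟨b, hbs, hbt⟩ := h2
  have ha : a ∈ interior t := by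
    rcases key a has with h | h
    · exact h
    · exact absurd (subset_closure hat) h
  have hb : b ∈ (closure t)ᶜ := by
    rcases key b hbs with h | h
    · exact absurd (interior_subset h) hbt
    · exact h
  obtain ⟨z, _, hz1, hz2⟩ := hs (interior t) (closure t)ᶜ isOpen_interior isClosed_closure.isOpen_compl
    key ⟨a, has, ha⟩ ⟨b, hbs, hb⟩
  exact hz2 (interior_subset_closure hz1)

section Lim

set_option linter.unusedSectionVars false

variable {V : Type*} [NormedAddCommGroup V] [InnerProductSpace ℝ V]

/-- Hausdorff convergence of sets, in terms of points. -/
def HLim (G : ℕ → Set V) (K : Set V) : Prop :=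
  (∀ ε > 0, ∀ᶠ k in atTop, ∀ x ∈ K, ∃ y ∈ G k, dist x y < ε) ∧
  (∀ ε > 0, ∀ᶠ k in atTop, ∀ y ∈ G k, ∃ x ∈ K, dist y x < ε)

lemma HLim.mem_of_frequently {G : ℕ → Set V} {K : Set V} (h : HLim G K) (hK : IsClosed K)
    {x : V} (hx : ∃ᶠ k in atTop, x ∈ G k) : x ∈ K := by
  rw [← hK.closure_eq, Metric.mem_closure_iff]
  intro ε hε
  obtain ⟨k, hk1, hk2⟩ := (hx.and_eventually (h.2 ε hε)).exists
  exact hk2 x hk1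

lemma HLim.convex {G : ℕ → Set V} {K : Set V} (h : HLim G K) (hK : IsClosed K)
    (hG : ∀ k, Convex ℝ (G k)) : Convex ℝ K := by
  intro x hx y hy a b ha hb hab
  rw [← hK.closure_eq, Metric.mem_closure_iff]
  intro ε hε
  obtain ⟨k, hk1, hk2⟩ := ((h.1 (ε / 2) (by positivity)).and (h.2 (ε / 2) (by positivity))).exists
  obtain ⟨x', hx', hxx⟩ := hk1 x hx
  obtain ⟨y', hy', hyy⟩ := hk1 y hy
  obtain ⟨z, hz, hzz⟩ := hk2 _ (hG k hx' hy' ha hb hab)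
  refine ⟨z, hz, ?_⟩
  have h1 : dist (a • x + b • y) (a • x' + b • y') ≤ ε / 2 := by
    calc dist (a • x + b • y) (a • x' + b • y')
        ≤ dist (a • x) (a • x') + dist (b • y) (b • y') := dist_add_add_le _ _ _ _
      _ = a * dist x x' + b * dist y y' := by
        rw [dist_smul₀, dist_smul₀, Real.norm_of_nonneg ha, Real.norm_of_nonneg hb]
      _ ≤ a * (ε / 2) + b * (ε / 2) := by gcongr
      _ = ε / 2 := by rw [← add_mul, hab, one_mul]
  calc dist (a • x + b • y) z ≤ _ := dist_triangle _ (a • x' + b • y') _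
    _ < ε := by linarith

/-- A point outside a complete convex set can be moved away from it. -/
lemma exists_far_point {G : Set V} (hne : G.Nonempty) (hc : IsComplete G) (hG : Convex ℝ G)
    {x : V} (hx : x ∉ G) {δ : ℝ} (hδ : 0 < δ) :
    ∃ z, dist z x = δ ∧ ∀ w ∈ G, δ ≤ dist z w := by
  obtain ⟨p, hp, hmin⟩ := exists_norm_eq_iInf_of_complete_convex hne hc hG x
  rw [norm_eq_iInf_iff_real_inner_le_zero hG hp] at hmin
  have hxp : 0 < ‖x - p‖ := by
    rw [norm_pos_iff, sub_ne_zero]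
    rintro rfl
    exact hx hp
  set u : V := (‖x - p‖)⁻¹ • (x - p) with hu
  have hun : ‖u‖ = 1 := by
    rw [hu, norm_smul, norm_inv, norm_norm, inv_mul_cancel₀ hxp.ne']
  refine ⟨x + δ • u, ?_, ?_⟩
  · rw [dist_eq_norm, add_sub_cancel_left, norm_smul, hun, mul_one, Real.norm_of_nonneg hδ.le]
  · intro w hw
    have h1 : inner ℝ u (x + δ • u - w) ≤ ‖x + δ • u - w‖ := by
      have := real_inner_le_norm u (x + δ • u - w)
      rwa [hun, one_mul] at this
    have h2 : x + δ • u - w = (x - p) + δ • u - (w - p) := by abel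
    have h3 : inner ℝ u (x + δ • u - w) =
        (‖x - p‖)⁻¹ * (‖x - p‖ * ‖x - p‖) + δ - (‖x - p‖)⁻¹ * inner ℝ (x - p) (w - p) := by
      rw [h2, inner_sub_right, inner_add_right, inner_smul_right,
        real_inner_self_eq_norm_mul_norm u, hun, hu, real_inner_smul_left, real_inner_smul_left,
        real_inner_self_eq_norm_mul_norm]
      ring
    have h4 : (‖x - p‖)⁻¹ * inner ℝ (x - p) (w - p) ≤ 0 :=
      mul_nonpos_of_nonneg_of_nonpos (by positivity) (hmin w hw)
    have h5 : 0 ≤ (‖x - p‖)⁻¹ * (‖x - p‖ * ‖x - p‖) := by positivity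
    rw [dist_eq_norm]
    linarith

lemma HLim.eventually_mem {G : ℕ → Set V} {K : Set V} (h : HLim G K)
    (hne : ∀ k, (G k).Nonempty) (hc : ∀ k, IsComplete (G k))
    (hG : ∀ k, Convex ℝ (G k)) {x : V} (hx : x ∈ interior K) : ∀ᶠ k in atTop, x ∈ G k := by
  obtain ⟨ε, hε, hb⟩ := Metric.isOpen_iff.1 isOpen_interior x hx
  filter_upwards [h.1 (ε / 2) (by positivity)] with k hk
  by_contra hxk
  obtain ⟨z, hz, hfar⟩ := exists_far_point (hne k) (hc k) (hG k) hxk (half_pos hε)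
  have hzK : z ∈ K := interior_subset (hb (by rw [Metric.mem_ball, hz]; linarith))
  obtain ⟨y, hy, hd⟩ := hk z hzK
  exact absurd hd (not_lt.2 (hfar y hy))

lemma HLim.frontier {G : ℕ → Set V} {K : Set V} (h : HLim G K) (hK : IsClosed K)
    {p : V} (hp : p ∈ frontier K) {ε : ℝ} (hε : 0 < ε) :
    ∀ᶠ k in atTop, ∃ q ∈ frontier (G k), dist p q < ε := by
  by_contra hcon
  rw [Filter.not_eventually] at hcon
  have hpK : p ∈ K := hK.frontier_subset hp
  have hfreq : ∃ᶠ k in atTop, ball p ε ⊆ G k := by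
    refine (hcon.and_eventually (h.1 ε hε)).mono ?_
    rintro k ⟨hk1, hk2⟩
    obtain ⟨y, hy, hyd⟩ := hk2 p hpK
    by_contra hnot
    obtain ⟨b, hb, hbG⟩ := Set.not_subset.1 hnot
    obtain ⟨q, hq1, hq2⟩ := preconn_meets_frontier (convex_ball p ε).isPreconnected
      ⟨y, by rwa [Metric.mem_ball, dist_comm], hy⟩ ⟨b, hb, hbG⟩
    exact hk1 ⟨q, hq2, by rwa [dist_comm]⟩
  have hsub : ball p ε ⊆ K := fun x hx =>
    h.mem_of_frequently hK (hfreq.mono fun k hk => hk hx)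
  exact hp.2 (mem_interior.2 ⟨ball p ε, hsub, isOpen_ball, mem_ball_self hε⟩)

lemma HLim.minkowski {G : ℕ → Set V} {K : Set V} (h : HLim G K) (hK : IsClosed K)
    {R : ℝ} {x : V} (hx : x ∈ thickening R (_root_.frontier K)) :
    ∀ᶠ k in atTop, x ∈ thickening R (_root_.frontier (G k)) := by
  obtain ⟨p, hp, hd⟩ := Metric.mem_thickening_iff.1 hx
  filter_upwards [h.frontier hK hp (sub_pos.2 hd)] with k hk
  obtain ⟨q, hq, hpq⟩ := hk
  refine Metric.mem_thickening_iff.2 ⟨q, hq, ?_⟩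
  linarith [dist_triangle x p q]

end Lim

/-! ## The functional on convex sets -/

section Conv

variable {n : ℕ}

lemma interior_nonempty_of_vol {F : Set (EuclideanSpace ℝ (Fin n))} (hF : Convex ℝ F)
    (hv : volume F ≠ 0) : (interior F).Nonempty := by
  by_contra h
  rw [Set.not_nonempty_iff_eq_empty] at h
  apply hv
  refine measure_mono_null ?_ (hF.addHaar_frontier volume)
  intro x hx
  exact ⟨subset_closure hx, by simp [h]⟩

lemma frontier_density {F : Set (EuclideanSpace ℝ (Fin n))} (hF : Convex ℝ F)
    (hi : (interior F).Nonempty) : frontier (densityOnePoints n F) = frontier F := by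
  have h1 : interior F ⊆ densityOnePoints n F := by
    intro x hx
    obtain ⟨ε, hε, hb⟩ := Metric.isOpen_iff.1 isOpen_interior x hx
    refine tendsto_const_nhds.congr' ?_
    filter_upwards [Ioo_mem_nhdsGT hε] with ρ hρ
    have hsub : ball x ρ ⊆ F :=
      ((ball_subset_ball hρ.2.le).trans hb).trans interior_subset
    rw [Set.inter_eq_right.2 hsub]
    exact (ENNReal.div_self (measure_ball_pos volume x hρ.1).ne' measure_ball_lt_top.ne).symm
  have h2 : densityOnePoints n F ⊆ closure F := by
    intro x hx
    by_contra hxc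
    obtain ⟨ε, hε, hb⟩ := Metric.isOpen_iff.1 isClosed_closure.isOpen_compl x hxc
    have h0 : Tendsto (fun ρ : ℝ => volume (F ∩ ball x ρ) / volume (ball x ρ))
        (nhdsWithin 0 (Ioi 0)) (nhds 0) := by
      refine tendsto_const_nhds.congr' ?_
      filter_upwards [Ioo_mem_nhdsGT hε] with ρ hρ
      have : F ∩ ball x ρ = ∅ := by
        rw [Set.eq_empty_iff_forall_notMem]
        rintro y ⟨hy1, hy2⟩
        exact hb (ball_subset_ball hρ.2.le hy2) (subset_closure hy1)
      simp [this]
    exact zero_ne_one (tendsto_nhds_unique h0 hx)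
  have hc : closure (densityOnePoints n F) = closure F := by
    apply subset_antisymm
    · exact closure_minimal h2 isClosed_closure
    · rw [← hF.closure_interior_eq_closure_of_nonempty_interior hi]
      exact closure_mono h1
  have hin : interior (densityOnePoints n F) = interior F := by
    apply subset_antisymm
    · rw [← hF.interior_closure_eq_interior_of_nonempty_interior hi]
      exact interior_mono h2
    · exact interior_maximal h1 isOpen_interior
  rw [frontier, frontier, hc, hin]

lemma perR_eq {F : Set (EuclideanSpace ℝ (Fin n))} (hF : Convex ℝ F)
    (hv : volume F ≠ 0) (R : ℝ) :
    perR n R F = volume (thickening R (frontier F)) / ENNReal.ofReal (2 * R) := by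
  rw [perR, frontier_density hF (interior_nonempty_of_vol hF hv), minkSum,
    Metric.thickening_eq_biUnion_ball]

lemma rieszEnergy_congr (α : ℝ) {E F : Set (EuclideanSpace ℝ (Fin n))}
    (h : E =ᵐ[volume] F) : rieszEnergy n α E = rieszEnergy n α F := by
  rw [rieszEnergy, rieszEnergy, Measure.restrict_congr_set h]

lemma closure_ae {F : Set (EuclideanSpace ℝ (Fin n))} (hF : Convex ℝ F) :
    (closure F : Set (EuclideanSpace ℝ (Fin n))) =ᵐ[volume] F :=
  closure_ae_eq_of_null_frontier (hF.addHaar_frontier volume)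

lemma interior_ae {F : Set (EuclideanSpace ℝ (Fin n))} (hF : Convex ℝ F) :
    (interior F : Set (EuclideanSpace ℝ (Fin n))) =ᵐ[volume] F :=
  interior_ae_eq_of_null_frontier (hF.addHaar_frontier volume)

lemma frontier_closure_convex {F : Set (EuclideanSpace ℝ (Fin n))} (hF : Convex ℝ F)
    (hi : (interior F).Nonempty) : frontier (closure F) = frontier F := by
  rw [frontier, frontier, closure_closure, hF.interior_closure_eq_interior_of_nonempty_interior hi]

lemma perR_closure {F : Set (EuclideanSpace ℝ (Fin n))} (hF : Convex ℝ F)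
    (hv : volume F ≠ 0) (R : ℝ) : perR n R (closure F) = perR n R F := by
  rw [perR_eq hF hv, perR_eq hF.closure (by rwa [measure_congr (closure_ae hF)]),
    frontier_closure_convex hF (interior_nonempty_of_vol hF hv)]

lemma perR_translate {F : Set (EuclideanSpace ℝ (Fin n))} (hF : Convex ℝ F)
    (hv : volume F ≠ 0) (R : ℝ) (v : EuclideanSpace ℝ (Fin n)) :
    perR n R (v +ᵥ F) = perR n R F := by
  rw [perR_eq hF hv, perR_eq (hF.vadd v) (by rwa [measure_vadd])]
  congr 1
  have h1 : frontier (v +ᵥ F) = v +ᵥ frontier F := by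
    rw [← Set.image_vadd, ← Set.image_vadd]
    exact ((Homeomorph.vadd v).image_frontier F).symm
  have h2 : thickening R (v +ᵥ frontier F) = v +ᵥ thickening R (frontier F) := by
    ext x
    rw [Set.mem_vadd_set_iff_neg_vadd_mem, Metric.mem_thickening_iff, Metric.mem_thickening_iff]
    constructor
    · rintro ⟨z, hz, hd⟩
      refine ⟨-v +ᵥ z, Set.mem_vadd_set_iff_neg_vadd_mem.1 hz, ?_⟩
      rwa [dist_vadd_cancel_left]
    · rintro ⟨z, hz, hd⟩
      refine ⟨v +ᵥ z, Set.vadd_mem_vadd_set hz, ?_⟩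
      rwa [← dist_vadd_cancel_left (-v), neg_vadd_vadd]
  rw [h1, h2, measure_vadd]

lemma rieszEnergy_translate (α : ℝ) (F : Set (EuclideanSpace ℝ (Fin n)))
    (v : EuclideanSpace ℝ (Fin n)) :
    rieszEnergy n α (v +ᵥ F) = rieszEnergy n α F := by
  have key : ∀ f : EuclideanSpace ℝ (Fin n) → ℝ≥0∞,
      ∫⁻ x in (v +ᵥ F), f x = ∫⁻ x in F, f (v + x) := by
    intro f
    have := (measurePreserving_add_left volume v).setLIntegral_comp_emb
      (measurableEmbedding_addLeft v) f F
    rw [this]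
    rfl
  rw [rieszEnergy, rieszEnergy, key]
  congr 1
  ext x
  rw [key]
  simp only [edist_add_left]

lemma exists_orth (hn : 2 ≤ n) (u : EuclideanSpace ℝ (Fin n)) :
    ∃ v : EuclideanSpace ℝ (Fin n), v ≠ 0 ∧ inner ℝ u v = 0 := by
  have h : (ℝ ∙ u)ᗮ ≠ ⊥ := by
    intro h
    rw [Submodule.orthogonal_eq_bot_iff] at h
    have h1 : Module.finrank ℝ (ℝ ∙ u) ≤ 1 := by
      simpa using finrank_span_le_card (R := ℝ) ({u} : Set (EuclideanSpace ℝ (Fin n)))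
    rw [h, finrank_top, finrank_euclideanSpace_fin] at h1
    omega
  obtain ⟨v, hv, hv0⟩ := Submodule.exists_mem_ne_zero_of_ne_bot h
  exact ⟨v, hv0, Submodule.mem_orthogonal_singleton_iff_inner_right.1 hv⟩

lemma many_balls (hn : 2 ≤ n) {F : Set (EuclideanSpace ℝ (Fin n))} (hF : Convex ℝ F)
    (hb : IsBounded F) {R : ℝ} (hR : 0 < R) {x y : EuclideanSpace ℝ (Fin n)} (hx : x ∈ F)
    (hy : y ∈ F) (hxy : x ≠ y) {N : ℕ} (hN : N * (2 * R) ≤ dist y x) :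
    (N : ℝ≥0∞) * volume (ball (0 : EuclideanSpace ℝ (Fin n)) R) ≤
      volume (thickening R (frontier F)) := by
  have hd : 0 < ‖y - x‖ := norm_pos_iff.2 (sub_ne_zero.2 hxy.symm)
  obtain ⟨v, hv0, hv⟩ := exists_orth hn (y - x)
  have hpt : ∀ j : Fin N, ∃ q ∈ frontier F,
      inner ℝ (y - x) (q - x) = ‖y - x‖ * (2 * R * (j : ℝ)) := by
    intro j
    set t : ℝ := 2 * R * (j : ℝ) / ‖y - x‖ with ht
    have hjN : (j : ℝ) ≤ N := by exact_mod_cast j.2.le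
    have ht0 : 0 ≤ t := by positivity
    have ht1 : t ≤ 1 := by
      rw [ht, div_le_one hd, ← dist_eq_norm]
      nlinarith
    have hw : x + t • (y - x) ∈ F := hF.add_smul_sub_mem hx hy ⟨ht0, ht1⟩
    set w := x + t • (y - x) with hwdef
    have hpre : IsPreconnected (Set.range fun s : ℝ => w + s • v) :=
      isPreconnected_range (by fun_prop)
    have hout : ((Set.range fun s : ℝ => w + s • v) ∩ Fᶜ).Nonempty := by
      obtain ⟨C, hC⟩ := hb.exists_norm_le
      have hvn : 0 < ‖v‖ := norm_pos_iff.2 hv0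
      refine ⟨w + ((C + ‖w‖ + 1) / ‖v‖) • v, ⟨_, rfl⟩, fun hmem => ?_⟩
      have h1 := hC _ hmem
      have hC0 : 0 ≤ C := (norm_nonneg _).trans h1
      have h2 : ‖((C + ‖w‖ + 1) / ‖v‖) • v‖ = C + ‖w‖ + 1 := by
        rw [norm_smul, Real.norm_of_nonneg (by positivity), div_mul_cancel₀ _ hvn.ne']
      have h3 := norm_sub_le (w + ((C + ‖w‖ + 1) / ‖v‖) • v) w
      rw [add_sub_cancel_left, h2] at h3
      linarith
    obtain ⟨q, ⟨s, hs⟩, hq⟩ := preconn_meets_frontier hpre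
      ⟨w, ⟨0, by simp⟩, hw⟩ hout
    refine ⟨q, hq, ?_⟩
    have : q - x = t • (y - x) + s • v := by
      rw [← hs, hwdef]; simp only []; abel
    rw [this, inner_add_right, inner_smul_right, inner_smul_right, hv,
      real_inner_self_eq_norm_mul_norm, ht]
    field_simp
    ring
  choose q hq hqi using hpt
  have hdisj : Pairwise (Function.onFun Disjoint fun j => ball (q j) R) := by
    intro i j hij
    apply ball_disjoint_ball
    have h1 : ‖y - x‖ * (2 * R * |(i : ℝ) - j|) ≤ ‖y - x‖ * dist (q i) (q j) := by
      have h2 := abs_real_inner_le_norm (y - x) (q i - q j)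
      have h3 : q i - q j = (q i - x) - (q j - x) := by abel
      have h4 : inner ℝ (y - x) (q i - q j) = ‖y - x‖ * (2 * R * ((i : ℝ) - j)) := by
        rw [h3, inner_sub_right, hqi, hqi]; ring
      rw [h4, abs_mul, abs_mul, abs_of_pos hd, abs_of_pos (by positivity : 0 < 2 * R)] at h2
      rwa [dist_eq_norm]
    have h5 := le_of_mul_le_mul_left h1 hd
    have h6 : (1 : ℝ) ≤ |(i : ℝ) - j| := by
      have : ((i : ℕ) : ℤ) - ((j : ℕ) : ℤ) ≠ 0 := by
        intro h; apply hij; apply Fin.ext; omega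
      have h7 := Int.one_le_abs this
      exact_mod_cast h7
    nlinarith
  calc (N : ℝ≥0∞) * volume (ball (0 : EuclideanSpace ℝ (Fin n)) R)
      = ∑ j : Fin N, volume (ball (q j) R) := by
        simp [Measure.addHaar_ball_center]
    _ = volume (⋃ j, ball (q j) R) := by
        rw [measure_iUnion hdisj (fun _ => measurableSet_ball), tsum_fintype]
    _ ≤ _ := by
        apply measure_mono
        refine iUnion_subset fun j => ?_
        exact ball_subset_thickening (hq j) R

lemma diam_bound (hn : 2 ≤ n) {R : ℝ} (hR : 0 < R) {C : ℝ≥0∞} (hC : C ≠ ⊤) :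
    ∃ D : ℝ, ∀ F : Set (EuclideanSpace ℝ (Fin n)), Convex ℝ F → IsBounded F → volume F ≠ 0 →
      perR n R F ≤ C → ∀ x ∈ F, ∀ y ∈ F, dist y x ≤ D := by
  have hb0 : volume (ball (0 : EuclideanSpace ℝ (Fin n)) R) ≠ 0 := (measure_ball_pos _ _ hR).ne'
  have hbt : volume (ball (0 : EuclideanSpace ℝ (Fin n)) R) ≠ ⊤ := measure_ball_lt_top.ne
  have hlt : C * ENNReal.ofReal (2 * R) / volume (ball (0 : EuclideanSpace ℝ (Fin n)) R) ≠ ⊤ :=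
    ENNReal.div_ne_top (ENNReal.mul_ne_top hC ENNReal.ofReal_ne_top) hb0
  obtain ⟨N, hN⟩ := ENNReal.exists_nat_gt hlt
  refine ⟨N * (2 * R), fun F hF hb hv hper x hx y hy => ?_⟩
  by_contra hcon
  push Not at hcon
  have hxy : x ≠ y := by
    rintro rfl
    rw [dist_self] at hcon
    have : 0 ≤ (N : ℝ) * (2 * R) := by positivity
    linarith
  have h1 := many_balls hn hF hb hR hx hy hxy hcon.le
  rw [perR_eq hF hv, ENNReal.div_le_iff (by simpa using hR) ENNReal.ofReal_ne_top] at hper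
  rw [ENNReal.div_lt_iff (Or.inl hb0) (Or.inl hbt)] at hN
  exact absurd (h1.trans hper) (not_le.2 hN)

/-- Fatou's lemma for sets. -/
lemma volume_le_liminf {A : Set (EuclideanSpace ℝ (Fin n))}
    {B : ℕ → Set (EuclideanSpace ℝ (Fin n))}
    (hA : MeasurableSet A) (hB : ∀ k, MeasurableSet (B k))
    (h : ∀ x ∈ A, ∀ᶠ k in atTop, x ∈ B k) :
    volume A ≤ liminf (fun k => volume (B k)) atTop := by
  have h1 := lintegral_liminf_le (μ := (volume : Measure (EuclideanSpace ℝ (Fin n))))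
    (u := atTop) (f := fun k => (B k).indicator (1 : EuclideanSpace ℝ (Fin n) → ℝ≥0∞))
    (fun k => measurable_one.indicator (hB k))
  simp only [lintegral_indicator_one (hB _)] at h1
  refine le_trans ?_ h1
  rw [← lintegral_indicator_one hA]
  refine lintegral_mono fun x => ?_
  by_cases hx : x ∈ A
  · rw [Set.indicator_of_mem hx]
    refine le_liminf_of_le (by isBoundedDefault) ?_
    filter_upwards [h x hx] with k hk
    rw [Set.indicator_of_mem hk]
  · rw [Set.indicator_of_notMem hx]
    exact zero_le

lemma riesz_le_liminf (α : ℝ) {A : Set (EuclideanSpace ℝ (Fin n))}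
    {B : ℕ → Set (EuclideanSpace ℝ (Fin n))}
    (hA : MeasurableSet A) (hB : ∀ k, MeasurableSet (B k))
    (h : ∀ x ∈ A, ∀ᶠ k in atTop, x ∈ B k) :
    rieszEnergy n α A ≤ liminf (fun k => rieszEnergy n α (B k)) atTop := by
  have hmeas : Measurable (fun p : EuclideanSpace ℝ (Fin n) × EuclideanSpace ℝ (Fin n) =>
      edist p.1 p.2 ^ (-α)) := by fun_prop
  -- general indicator form of Fatou
  have gen : ∀ (f : EuclideanSpace ℝ (Fin n) → ℝ≥0∞)
      (g : ℕ → EuclideanSpace ℝ (Fin n) → ℝ≥0∞), (∀ k, Measurable (g k)) →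
      (∀ x, f x ≤ liminf (fun k => g k x) atTop) →
      ∫⁻ x in A, f x ≤ liminf (fun k => ∫⁻ x in B k, g k x) atTop := by
    intro f g hg hfg
    have h1 := lintegral_liminf_le (μ := (volume : Measure (EuclideanSpace ℝ (Fin n))))
      (u := atTop) (f := fun k => (B k).indicator (g k)) (fun k => (hg k).indicator (hB k))
    simp only [lintegral_indicator (hB _)] at h1
    refine le_trans ?_ h1
    rw [← lintegral_indicator hA]
    refine lintegral_mono fun x => ?_
    by_cases hx : x ∈ A
    · rw [Set.indicator_of_mem hx]
      refine (hfg x).trans (le_of_eq ?_)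
      refine liminf_congr ?_
      filter_upwards [h x hx] with k hk
      rw [Set.indicator_of_mem hk]
    · rw [Set.indicator_of_notMem hx]
      exact zero_le
  refine gen _ _ (fun k => ?_) (fun x => ?_)
  · exact Measurable.lintegral_prod_right' hmeas
  · refine gen _ _ (fun k => ?_) (fun y => ?_)
    · fun_prop
    · simp

end Conv

section Main

open TopologicalSpace

variable {n : ℕ}

lemma exists_ball_vol (hn : 2 ≤ n) {m : ℝ} (hm : 0 < m) :
    ∃ E : Set (EuclideanSpace ℝ (Fin n)), IsBounded E ∧ Convex ℝ E ∧
      volume E = ENNReal.ofReal m := by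
  set c := (volume (ball (0 : EuclideanSpace ℝ (Fin n)) 1)).toReal with hc
  have hct : volume (ball (0 : EuclideanSpace ℝ (Fin n)) 1) ≠ ⊤ := measure_ball_lt_top.ne
  have hc0 : 0 < c := ENNReal.toReal_pos (measure_ball_pos _ _ one_pos).ne' hct
  have hn0 : n ≠ 0 := by omega
  have : Nonempty (Fin n) := ⟨⟨0, by omega⟩⟩
  refine ⟨ball 0 ((m / c) ^ ((n : ℝ)⁻¹)), isBounded_ball, convex_ball _ _, ?_⟩
  rw [Measure.addHaar_ball volume _ (by positivity), finrank_euclideanSpace_fin,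
    Real.rpow_inv_natCast_pow (by positivity) hn0, ← ENNReal.ofReal_toReal hct, ← hc,
    ← ENNReal.ofReal_mul (by positivity), div_mul_cancel₀ _ hc0.ne']

/-- Blaschke selection, in the form needed here. -/
lemma blaschke {G : ℕ → Set (EuclideanSpace ℝ (Fin n))} (hne : ∀ k, (G k).Nonempty)
    (hcl : ∀ k, IsClosed (G k)) {D : ℝ} (hD : ∀ k, G k ⊆ closedBall 0 D) :
    ∃ K : Set (EuclideanSpace ℝ (Fin n)), IsCompact K ∧
      ∃ φ : ℕ → ℕ, StrictMono φ ∧ HLim (fun k => G (φ k)) K := by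
  have hcB : IsCompact (closedBall (0 : EuclideanSpace ℝ (Fin n)) D) := isCompact_closedBall _ _
  let N : ℕ → NonemptyCompacts (EuclideanSpace ℝ (Fin n)) := fun k =>
    ⟨⟨G k, hcB.of_isClosed_subset (hcl k) (hD k)⟩, hne k⟩
  have hN : ∀ k, (N k : Set (EuclideanSpace ℝ (Fin n))) = G k := fun k => rfl
  obtain ⟨K, -, φ, hφ, hlim⟩ :=
    (NonemptyCompacts.isCompact_subsets_of_isCompact hcB).tendsto_subseq (x := N) hD
  refine ⟨K, K.isCompact, φ, hφ, ?_⟩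
  have hfin : ∀ k, hausdorffEDist (G (φ k)) (K : Set (EuclideanSpace ℝ (Fin n))) ≠ ⊤ := fun k =>
    hausdorffEDist_ne_top_of_nonempty_of_bounded (hne _) K.nonempty
      (isBounded_closedBall.subset (hD _)) K.isCompact.isBounded
  have hev : ∀ ε > 0, ∀ᶠ k in atTop,
      hausdorffDist (G (φ k)) (K : Set (EuclideanSpace ℝ (Fin n))) < ε := by
    intro ε hε
    filter_upwards [(Metric.tendsto_nhds.1 hlim) ε hε] with k hk
    rwa [NonemptyCompacts.dist_eq] at hk
  constructor
  · intro ε hε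
    filter_upwards [hev ε hε] with k hk x hx
    obtain ⟨y, hy, hd⟩ := exists_dist_lt_of_hausdorffDist_lt' hx hk (hfin k)
    exact ⟨y, hy, by rwa [dist_comm]⟩
  · intro ε hε
    filter_upwards [hev ε hε] with k hk y hy
    exact exists_dist_lt_of_hausdorffDist_lt hy hk (hfin k)

lemma volume_limit {G : ℕ → Set (EuclideanSpace ℝ (Fin n))} {K : Set (EuclideanSpace ℝ (Fin n))}
    (h : HLim G K) (hK : IsCompact K) (hne : ∀ k, (G k).Nonempty)
    (hcl : ∀ k, IsClosed (G k)) (hconv : ∀ k, Convex ℝ (G k)) {M : ℝ≥0∞}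
    (hM : ∀ k, volume (G k) = M) : volume K = M := by
  apply le_antisymm
  · have hKc := h.convex hK.isClosed hconv
    rw [← measure_congr (interior_ae hKc)]
    have := volume_le_liminf isOpen_interior.measurableSet (fun k => (hcl k).measurableSet)
      (fun x hx => h.eventually_mem hne (fun k => (hcl k).isComplete) hconv hx)
    simpa [hM] using this
  · have ht := (tendsto_measure_cthickening_of_isCompact
      (μ := (volume : Measure (EuclideanSpace ℝ (Fin n)))) hK)
    have ht' := ht.mono_left (nhdsWithin_le_nhds (s := Ioi (0 : ℝ)))
    refine ge_of_tendsto ht' ?_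
    filter_upwards [self_mem_nhdsWithin] with ε hε
    obtain ⟨k, hk⟩ := (h.2 ε hε).exists
    rw [← hM k]
    apply measure_mono
    intro y hy
    exact thickening_subset_cthickening _ _ (Metric.mem_thickening_iff.2 (hk y hy))

lemma liminf_add_ge (f g : ℕ → ℝ≥0∞) :
    liminf f atTop + liminf g atTop ≤ liminf (fun k => f k + g k) atTop := by
  simp only [liminf_eq_iSup_iInf_of_nat]
  rw [ENNReal.iSup_add_iSup_of_monotone]
  · refine iSup_mono fun k => le_iInf₂ fun i hi => ?_
    exact add_le_add (iInf₂_le i hi) (iInf₂_le i hi)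
  · intro a b hab
    exact le_iInf₂ fun i hi => iInf₂_le i (le_trans hab hi)
  · intro a b hab
    exact le_iInf₂ fun i hi => iInf₂_le i (le_trans hab hi)

end Main

/-- Existence of minimizers of `Per_{r m^{1/n}} + Φ_α` among bounded convex
sets of volume `m`. -/
theorem exists_minimizer_convex (n : ℕ) (hn : 2 ≤ n) (α r : ℝ) (hα : 0 < α) (hαn : α < n)
    (hr : 0 < r) (m : ℝ) (hm : 0 < m) :
    ∃ E : Set (EuclideanSpace ℝ (Fin n)), IsBounded E ∧ Convex ℝ E ∧
      volume E = ENNReal.ofReal m ∧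
      ∀ F : Set (EuclideanSpace ℝ (Fin n)), IsBounded F → Convex ℝ F →
        volume F = ENNReal.ofReal m →
        perR n (r * m ^ ((n : ℝ)⁻¹)) E + rieszEnergy n α E ≤
          perR n (r * m ^ ((n : ℝ)⁻¹)) F + rieszEnergy n α F := by
  have hR : 0 < r * m ^ ((n : ℝ)⁻¹) := by positivity
  generalize r * m ^ ((n : ℝ)⁻¹) = R at hR
  have hm0 : ENNReal.ofReal m ≠ 0 := by simpa using hm
  set J : Set (EuclideanSpace ℝ (Fin n)) → ℝ≥0∞ := fun F => perR n R F + rieszEnergy n α F with hJ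
  set 𝒞 : Set (Set (EuclideanSpace ℝ (Fin n))) :=
    {F | IsBounded F ∧ Convex ℝ F ∧ volume F = ENNReal.ofReal m} with h𝒞
  obtain ⟨E₀, hE₀⟩ : 𝒞.Nonempty := exists_ball_vol hn hm
  by_cases htop : sInf (J '' 𝒞) = ⊤
  · refine ⟨E₀, hE₀.1, hE₀.2.1, hE₀.2.2, fun F h1 h2 h3 => ?_⟩
    have : J F = ⊤ := sInf_eq_top.1 htop _ ⟨F, ⟨h1, h2, h3⟩, rfl⟩
    exact le_of_le_of_eq le_top this.symm
  obtain ⟨u, -, hu, humem⟩ := exists_seq_tendsto_sInf (S := J '' 𝒞) ⟨_, E₀, hE₀, rfl⟩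
    (OrderBot.bddBelow _)
  choose F₀ hF₀ hF₀u using humem
  have hlt : sInf (J '' 𝒞) < sInf (J '' 𝒞) + 1 := ENNReal.lt_add_right htop one_ne_zero
  obtain ⟨k₀, hk₀⟩ := Filter.eventually_atTop.1 (hu.eventually (gt_mem_nhds hlt))
  obtain ⟨D, hD⟩ := diam_bound hn hR (C := sInf (J '' 𝒞) + 1) (by simp [htop])
  -- normalized minimizing sequence
  have hG : ∀ k, ∃ G : Set (EuclideanSpace ℝ (Fin n)), G.Nonempty ∧ IsClosed G ∧ Convex ℝ G ∧
      volume G = ENNReal.ofReal m ∧ G ⊆ closedBall 0 D ∧ J G = u (k + k₀) := by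
    intro k
    obtain ⟨hb, hc, hv⟩ := hF₀ (k + k₀)
    set F := F₀ (k + k₀) with hFdef
    have hv0 : volume F ≠ 0 := by rwa [hv]
    have hcv : volume (closure F) = ENNReal.ofReal m := by
      rw [measure_congr (closure_ae hc), hv]
    have hcv0 : volume (closure F) ≠ 0 := by rwa [hcv]
    have hJF : J (closure F) = u (k + k₀) := by
      rw [← hF₀u, ← hFdef]
      simp only [hJ]
      rw [perR_closure hc hv0, rieszEnergy_congr α (closure_ae hc)]
    have hper : perR n R (closure F) ≤ sInf (J '' 𝒞) + 1 := by
      refine le_trans le_self_add (?_ : J (closure F) ≤ _)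
      rw [hJF]
      exact (hk₀ _ (by omega)).le
    obtain ⟨p, hp⟩ : (closure F).Nonempty := nonempty_of_measure_ne_zero hcv0
    refine ⟨-p +ᵥ closure F, ⟨_, Set.vadd_mem_vadd_set hp⟩, isClosed_closure.vadd _,
      hc.closure.vadd _, by rw [measure_vadd, hcv], ?_, ?_⟩
    · rintro _ ⟨q, hq, rfl⟩
      have := hD _ hc.closure hb.closure hcv0 hper p hp q hq
      rw [mem_closedBall_zero_iff]
      rw [dist_eq_norm] at this
      simpa [vadd_eq_add, neg_add_eq_sub] using this
    · rw [← hJF]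
      simp only [hJ]
      rw [perR_translate hc.closure hcv0, rieszEnergy_translate]
  choose G hGne hGcl hGc hGv hGD hGJ using hG
  obtain ⟨K, hK, φ, hφ, hlim⟩ := blaschke hGne hGcl hGD
  have hKv : volume K = ENNReal.ofReal m :=
    volume_limit hlim hK (fun k => hGne _) (fun k => hGcl _) (fun k => hGc _) (fun k => hGv _)
  have hKc : Convex ℝ K := hlim.convex hK.isClosed (fun k => hGc _)
  refine ⟨K, hK.isBounded, hKc, hKv, fun F h1 h2 h3 => ?_⟩
  have hinf : sInf (J '' 𝒞) ≤ J F := sInf_le ⟨F, ⟨h1, h2, h3⟩, rfl⟩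
  refine le_trans ?_ hinf
  have hconv : Tendsto (fun k => J (G (φ k))) atTop (nhds (sInf (J '' 𝒞))) := by
    simp only [hGJ]
    exact hu.comp ((tendsto_add_atTop_nat k₀).comp hφ.tendsto_atTop)
  rw [← hconv.liminf_eq]
  have hP : perR n R K ≤ liminf (fun k => perR n R (G (φ k))) atTop := by
    have hp : ∀ k, perR n R (G (φ k)) =
        (ENNReal.ofReal (2 * R))⁻¹ * volume (thickening R (frontier (G (φ k)))) := fun k => by
      rw [perR_eq (hGc _) (by rwa [hGv]), ENNReal.div_eq_inv_mul]
    simp only [hp]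
    rw [perR_eq hKc (by rwa [hKv]), ENNReal.div_eq_inv_mul]
    rw [ENNReal.liminf_const_mul_of_ne_top
      (ENNReal.inv_ne_top.2 (by simpa using hR))]
    gcongr
    exact volume_le_liminf isOpen_thickening.measurableSet
      (fun k => isOpen_thickening.measurableSet) (fun x hx => hlim.minkowski hK.isClosed hx)
  have hE : rieszEnergy n α K ≤ liminf (fun k => rieszEnergy n α (G (φ k))) atTop := by
    rw [← rieszEnergy_congr α (interior_ae hKc)]
    exact riesz_le_liminf α isOpen_interior.measurableSet (fun k => (hGcl _).measurableSet)
      (fun x hx => hlim.eventually_mem (fun k => hGne _) (fun k => (hGcl _).isComplete)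
        (fun k => hGc _) hx)
  exact (add_le_add hP hE).trans (liminf_add_ge _ _)
end
end
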